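/- Let i, j with |i−j| = 1 and let x be a Kostant partition with f_i(x) ≠ 0. Then φ_j(f_i(x)) equals either φ_j(x) or φ_j(x) + 1 (Stembridge axiom S1' for the modified operators in the adjacent case). -/

import Mathlib

open scoped BigOperators

namespace KFC

/-- A (candidate) root is a pair of 1-based indices. -/
abbrev Root : Type := ℕ × ℕ

/-- A Kostant partition is encoded as a multiplicity function on pairs. -/
abbrev KPf : Type := Root → ℕ

/-- An entry of a signed word: a sign (`true` = '+', `false` = '−') together
with the root lying under it. -/
abbrev Entry : Type := Bool × Root

/-- `p` is a positive root of type `A_{n-1}`. -/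
def IsPos (n : ℕ) (p : Root) : Prop := 1 ≤ p.1 ∧ p.1 < p.2 ∧ p.2 ≤ n

/-- `α` is a genuine Kostant partition for type `A_{n-1}`: it is supported on
positive roots. -/
def IsKP (n : ℕ) (α : KPf) : Prop := ∀ p, α p ≠ 0 → IsPos n p

/-- Add one copy of the root `r`. -/
def KPadd (α : KPf) (r : Root) : KPf := fun p => if p = r then α p + 1 else α p

/-- Remove one copy of the root `r`. -/
def KPsub (α : KPf) (r : Root) : KPf := fun p => if p = r then α p - 1 else α p

/-- Replace one copy of `r` by one copy of `r'`. -/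
def KPmove (α : KPf) (r r' : Root) : KPf := KPadd (KPsub α r) r'

/-- The signed word `W_i` of `α`: roots `(a,b)` ordered by decreasing `a` and,
for equal `a`, increasing `b`; a '+' under each `(h,i)` and a '−' under each
`(h,i+1)`. -/
def Wword (n i : ℕ) (α : KPf) : List Entry :=
  ((List.range (n+1)).reverse).flatMap (fun h =>
    List.replicate (α (h, i)) ((true, (h, i)) : Entry) ++
    List.replicate (α (h, i+1)) ((false, (h, i+1)) : Entry))

/-- The signed word `W_i*` of `α`: roots `(a,b)` ordered by increasing `b` and,
for equal `b`, decreasing `a`; a '+' under each `(i+1,j)` and a '−' under each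
`(i,j)`. -/
def Wstar (n i : ℕ) (α : KPf) : List Entry :=
  (List.range (n+1)).flatMap (fun j =>
    List.replicate (α (i+1, j)) ((true, (i+1, j)) : Entry) ++
    List.replicate (α (i, j)) ((false, (i, j)) : Entry))

/-- One step of the left-to-right reduction: a new '+' cancels the rightmost
surviving '−' (the surviving word always has the shape `+^a −^b`). -/
def redStep (s : List Entry) (e : Entry) : List Entry :=
  match e.1, s.getLast? with
  | true, some (false, _) => s.dropLast
  | _, _ => s ++ [e]

/-- The reduced word (list of surviving entries, in order). -/
def reduceW (w : List Entry) : List Entry := w.foldl redStep []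

def plusCt (w : List Entry) : ℕ := (w.filter (fun e => e.1)).length
def minusCt (w : List Entry) : ℕ := (w.filter (fun e => !e.1)).length

/-- `a_i`: number of '+' in the reduced word of `W_i`. -/
def aSt (n i : ℕ) (α : KPf) : ℕ := plusCt (reduceW (Wword n i α))
/-- `b_i`: number of '−' in the reduced word of `W_i`. -/
def bSt (n i : ℕ) (α : KPf) : ℕ := minusCt (reduceW (Wword n i α))
/-- `a_i*`. -/
def aStar (n i : ℕ) (α : KPf) : ℕ := plusCt (reduceW (Wstar n i α))
/-- `b_i*`. -/
def bStar (n i : ℕ) (α : KPf) : ℕ := minusCt (reduceW (Wstar n i α))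
/-- `u_i`: number of '+' in the reduced word of `W_i* W_i`. -/
def uSt (n i : ℕ) (α : KPf) : ℕ := plusCt (reduceW (Wstar n i α ++ Wword n i α))
/-- `v_i`: number of '−' in the reduced word of `W_i* W_i`. -/
def vSt (n i : ℕ) (α : KPf) : ℕ := minusCt (reduceW (Wstar n i α ++ Wword n i α))

/-- The root under the rightmost surviving '+'. -/
def lastPlus (w : List Entry) : Option Root :=
  (((reduceW w).filter (fun e => e.1)).getLast?).map Prod.snd

/-- The root under the leftmost surviving '−'. -/
def headMinus (w : List Entry) : Option Root :=
  (((reduceW w).filter (fun e => !e.1)).head?).map Prod.snd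

/-- The operator `f̃_i`. -/
def ftilde (n i : ℕ) (α : KPf) : Option KPf :=
  match lastPlus (Wword n i α) with
  | some r => some (KPmove α r (r.1, i+1))
  | none => some (KPadd α (i, i+1))

/-- The operator `ẽ_i`. -/
def etilde (n i : ℕ) (α : KPf) : Option KPf :=
  match headMinus (Wword n i α) with
  | some r => if r = (i, i+1) then some (KPsub α (i, i+1)) else some (KPmove α r (r.1, i))
  | none => none

/-- The operator `f̃_i*`. -/
def ftildeS (n i : ℕ) (α : KPf) : Option KPf :=
  match lastPlus (Wstar n i α) with
  | some r => some (KPmove α r (i, r.2))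
  | none => some (KPadd α (i, i+1))

/-- The operator `ẽ_i*`. -/
def etildeS (n i : ℕ) (α : KPf) : Option KPf :=
  match headMinus (Wstar n i α) with
  | some r => if r = (i, i+1) then some (KPsub α (i, i+1)) else some (KPmove α r (i+1, r.2))
  | none => none

/-- The modified operator `f_i`. -/
def fop (n i : ℕ) (α : KPf) : Option KPf :=
  if bStar n i α < aSt n i α then ftilde n i α
  else if 0 < aStar n i α then ftildeS n i α
  else none

/-- The modified operator `e_i`. -/
def eop (n i : ℕ) (α : KPf) : Option KPf :=
  if bStar n i α ≤ aSt n i α then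
    (if 0 < bSt n i α ∧ headMinus (Wword n i α) ≠ some (i, i+1) then etilde n i α else none)
  else
    (if headMinus (Wstar n i α) ≠ some (i, i+1) then etildeS n i α else none)

/-- The operator `ê_i`. -/
def ehat (n i : ℕ) (α : KPf) : Option KPf :=
  if bStar n i α ≤ aSt n i α then (if 0 < bSt n i α then etilde n i α else none)
  else etildeS n i α

/-- Iterate a partially defined operator (`none` plays the role of `0`). -/
def iterO (g : KPf → Option KPf) : ℕ → KPf → Option KPf
  | 0, x => some x
  | k+1, x => (g x).bind (iterO g k)

/-- `ε_i(x) = max {k : e_i^k x ≠ 0}`. -/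
noncomputable def epsS (n i : ℕ) (x : KPf) : ℕ := sSup {k | iterO (eop n i) k x ≠ none}
/-- `ε̂_i(x) = max {k : ê_i^k x ≠ 0}`. -/
noncomputable def epsHatS (n i : ℕ) (x : KPf) : ℕ := sSup {k | iterO (ehat n i) k x ≠ none}
/-- `φ_i(x) = max {k : f_i^k x ≠ 0}`. -/
noncomputable def phiS (n i : ℕ) (x : KPf) : ℕ := sSup {k | iterO (fop n i) k x ≠ none}

noncomputable def epsO (n i : ℕ) (o : Option KPf) : ℕ := o.elim 0 (epsS n i)
noncomputable def epsHatO (n i : ℕ) (o : Option KPf) : ℕ := o.elim 0 (epsHatS n i)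
noncomputable def phiO (n i : ℕ) (o : Option KPf) : ℕ := o.elim 0 (phiS n i)

/-- `e_l(γ) ≃ 0`. -/
def simZero (n l : ℕ) (γ : KPf) : Prop := eop n l γ ≠ ehat n l γ

/-- `e_l e_m (γ) ≃ 0`. -/
def simZero2 (n l m : ℕ) (γ : KPf) : Prop := ∃ δ, eop n m γ = some δ ∧ simZero n l δ

/-- The box containing all relevant pairs. -/
def kbox (n : ℕ) : Finset (ℕ × ℕ) := Finset.range (n+1) ×ˢ Finset.range (n+1)

/-- `|α|`: number of parts of the Kostant partition. -/
def kpSize (n : ℕ) (α : KPf) : ℕ := ∑ p ∈ kbox n, α p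

/-- The evaluation `ᾱ ∈ ℤ^n` (as a function on 1-based coordinates). -/
def kpEval (n : ℕ) (α : KPf) : ℕ → ℤ :=
  fun k => ∑ p ∈ kbox n, (α p : ℤ) * ((if p.1 = k then 1 else 0) - (if p.2 = k then 1 else 0))

/-- The simple root `α_i = ε_i − ε_{i+1}` as a vector. -/
def srVec (i : ℕ) : ℕ → ℤ := fun k => (if k = i then 1 else 0) - (if k = i+1 then 1 else 0)

/-- `ρ = (n-1, n-2, …, 1, 0)` (on 1-based coordinates `1..n`). -/
def rhoVec (n : ℕ) : ℕ → ℤ := fun k => (n : ℤ) - k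

/-- `⟨γ, α_i^∨⟩ = γ_i − γ_{i+1}`. -/
def pairCo (γ : ℕ → ℤ) (i : ℕ) : ℤ := γ i - γ (i+1)

/-- The permutation of 1-based coordinates induced by `w : Perm (Fin n)`. -/
def extP (n : ℕ) (w : Equiv.Perm (Fin n)) (k : ℕ) : ℕ :=
  if h : 1 ≤ k ∧ k ≤ n then ((w ⟨k - 1, by omega⟩ : Fin n) : ℕ) + 1 else k

/-- `S_n` acting on `ℤ^n` by permuting coordinates: `(w·v)_k = v_{w⁻¹(k)}`. -/
def permAct (n : ℕ) (w : Equiv.Perm (Fin n)) (v : ℕ → ℤ) : ℕ → ℤ :=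
  fun k => v (extP n w⁻¹ k)

/-- The simple transposition `s_i = (i, i+1)` (1-based). -/
def sT (n i : ℕ) : Equiv.Perm (Fin n) :=
  if h : 1 ≤ i ∧ i < n then Equiv.swap ⟨i - 1, by omega⟩ ⟨i, h.2⟩ else 1

/-- Coxeter length = number of inversions. -/
def lenP (n : ℕ) (w : Equiv.Perm (Fin n)) : ℕ :=
  (Finset.univ.filter (fun p : Fin n × Fin n => p.1 < p.2 ∧ w p.2 < w p.1)).card

/-- The left weak Bruhat order: `u ≤ w` iff `ℓ(w) = ℓ(w u⁻¹) + ℓ(u)`. -/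
def leftWeakLE (n : ℕ) (u w : Equiv.Perm (Fin n)) : Prop :=
  lenP n w = lenP n (w * u⁻¹) + lenP n u

/-- `λ + ρ` as a vector. -/
def lamRho (n : ℕ) (lam : ℕ → ℤ) : ℕ → ℤ := fun k => lam k + rhoVec n k

/-- `(w, α) ∈ S_{λ,μ}`, i.e. `ᾱ = w(λ+ρ) − (μ+ρ)`. -/
def InS (n : ℕ) (lam mu : ℕ → ℤ) (w : Equiv.Perm (Fin n)) (α : KPf) : Prop :=
  IsKP n α ∧ ∀ k, 1 ≤ k → k ≤ n →
    kpEval n α k = permAct n w (lamRho n lam) k - (mu k + rhoVec n k)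

/-- A directed edge `(w,α) →^i (s_i w, β)` of the `Φ`-graph. -/
def PhiEdge (n : ℕ) (lam mu : ℕ → ℤ) (v v' : Equiv.Perm (Fin n) × KPf) : Prop :=
  InS n lam mu v.1 v.2 ∧ InS n lam mu v'.1 v'.2 ∧
  ∃ i, 1 ≤ i ∧ i ≤ n - 1 ∧
    pairCo (permAct n v.1 (lamRho n lam)) i < 0 ∧
    v'.1 = sT n i * v.1 ∧
    iterO (fop n i) (-(pairCo (permAct n v.1 (lamRho n lam)) i)).toNat v.2 = some v'.2

/-- Being in the same connected component of (the underlying undirected graph of)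
the `Φ`-graph. -/
def Conn (n : ℕ) (lam mu : ℕ → ℤ) (v v' : Equiv.Perm (Fin n) × KPf) : Prop :=
  Relation.ReflTransGen (fun a b => PhiEdge n lam mu a b ∨ PhiEdge n lam mu b a) v v'

/-- `(w,β)` has a broken hexagon, broken by `Φ_i` after `Φ_j`. -/
def BrokenHexAt (n : ℕ) (lam mu : ℕ → ℤ) (w : Equiv.Perm (Fin n)) (β : KPf) (i j : ℕ) : Prop :=
  (j = i + 1 ∨ i = j + 1) ∧ 1 ≤ i ∧ i ≤ n - 1 ∧ 1 ≤ j ∧ j ≤ n - 1 ∧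
  0 < pairCo (permAct n w (lamRho n lam)) i ∧
  0 < pairCo (permAct n w (lamRho n lam)) j ∧
  iterO (eop n i) (pairCo (permAct n w (lamRho n lam)) i).toNat β ≠ none ∧
  ∃ δ, iterO (eop n j) (pairCo (permAct n w (lamRho n lam)) j).toNat β = some δ ∧
    epsS n i δ < (pairCo (permAct n w (lamRho n lam)) i).toNat +
      (pairCo (permAct n w (lamRho n lam)) j).toNat

/-- `γ` is obtained from `β` by an initial segment of the operator sequence
(`e_i` applied `ki` times, then `e_j` applied `ki+kj` times, then `e_i` applied
`kj` times). -/
def alongPath (n i j ki kj : ℕ) (β γ : KPf) : Prop :=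
  (∃ a ≤ ki, iterO (eop n i) a β = some γ) ∨
  (∃ b ≤ ki + kj, (iterO (eop n i) ki β).bind (iterO (eop n j) b) = some γ) ∨
  (∃ c ≤ kj, ((iterO (eop n i) ki β).bind (iterO (eop n j) (ki + kj))).bind
      (iterO (eop n i) c) = some γ)

/-- Conjecture A: no broken diamonds along the hexagon paths. -/
def ConjA (n : ℕ) (lam mu : ℕ → ℤ) : Prop :=
  ∀ (w : Equiv.Perm (Fin n)) (β : KPf) (i j : ℕ),
    InS n lam mu w β → 1 ≤ i → i ≤ n - 1 → 1 ≤ j → j ≤ n - 1 → (j = i + 1 ∨ i = j + 1) →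
    ∀ ki kj : ℤ,
      ki = pairCo (permAct n w (lamRho n lam)) i →
      kj = pairCo (permAct n w (lamRho n lam)) j →
      0 < ki → 0 < kj →
      iterO (eop n i) ki.toNat β ≠ none → iterO (eop n j) kj.toNat β ≠ none →
      ∀ γ : KPf,
        (alongPath n i j ki.toNat kj.toNat β γ ∨ alongPath n j i kj.toNat ki.toNat β γ) →
        ¬ (simZero2 n i j γ ∧ simZero2 n j i γ)

/-- Conjecture B: broken hexagons propagate up to the source vertex. -/
def ConjB (n : ℕ) (lam mu : ℕ → ℤ) : Prop :=
  ∀ (w : Equiv.Perm (Fin n)) (β α : KPf) (i j : ℕ),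
    InS n lam mu w β → InS n lam mu 1 α → Conn n lam mu (1, α) (w, β) →
    BrokenHexAt n lam mu w β i j → ∃ j', BrokenHexAt n lam mu 1 α i j'

/-- The Kostka–Foulkes polynomial `K_{λ,μ}(t) = Σ_{(w,α) ∈ S_{λ,μ}} sgn(w) t^{|α|}`. -/
noncomputable def KF (n : ℕ) (lam mu : ℕ → ℤ) : Polynomial ℤ :=
  ∑ᶠ (w : Equiv.Perm (Fin n)) (α : KPf) (_ : InS n lam mu w α),
    ((Equiv.Perm.sign w : ℤ) • (Polynomial.X ^ kpSize n α) : Polynomial ℤ)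

end KFC


namespace KFC

/-- Number of surviving pluses of the block word `∏ₕ (+)^{p h} (−)^{q h}`, `h` running over the
list, read with `b` minuses already pending. -/
def surv (p q : ℕ → ℕ) : ℕ → List ℕ → ℕ
  | _, [] => 0
  | b, h :: l => (p h - b) + surv p q ((b - p h) + q h) l

/-- Number of minuses pending after reading the block word `∏ₕ (+)^{p h} (−)^{q h}`, starting with
`b` pending minuses. -/
def pend (p q : ℕ → ℕ) : ℕ → List ℕ → ℕ
  | b, [] => b
  | b, h :: l => pend p q ((b - p h) + q h) l

/-- The surviving pluses of a block word whose block `h` carries the root `r h` under its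
pluses. -/
def survList (p q : ℕ → ℕ) (r : ℕ → Root) : ℕ → List ℕ → List Entry
  | _, [] => []
  | b, h :: l => List.replicate (p h - b) (true, r h) ++ survList p q r ((b - p h) + q h) l

/-- A word made of blocks of pluses followed by minuses. -/
def blockWord (p q : ℕ → ℕ) (r r' : ℕ → Root) (l : List ℕ) : List Entry :=
  l.flatMap fun h =>
    List.replicate (p h) ((true, r h) : Entry) ++ List.replicate (q h) ((false, r' h) : Entry)

theorem length_survList (p q : ℕ → ℕ) (r : ℕ → Root) (b : ℕ) (l : List ℕ) :
    (survList p q r b l).length = surv p q b l := by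
  induction l generalizing b with
  | nil => rfl
  | cons h l ih => simp [survList, surv, ih]

theorem survList_fst (p q : ℕ → ℕ) (r : ℕ → Root) (b : ℕ) (l : List ℕ) :
    ∀ e ∈ survList p q r b l, e.1 = true := by
  induction l generalizing b with
  | nil => simp [survList]
  | cons h l ih =>
    intro e he
    simp only [survList, List.mem_append, List.mem_replicate] at he
    rcases he with ⟨-, rfl⟩ | he
    · rfl
    · exact ih _ e he

theorem surv_append (p q : ℕ → ℕ) (b : ℕ) (l l' : List ℕ) :
    surv p q b (l ++ l') = surv p q b l + surv p q (pend p q b l) l' := by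
  induction l generalizing b with
  | nil => simp [surv, pend]
  | cons h l ih => simp [surv, pend, ih, add_assoc]

theorem pend_append (p q : ℕ → ℕ) (b : ℕ) (l l' : List ℕ) :
    pend p q b (l ++ l') = pend p q (pend p q b l) l' := by
  induction l generalizing b with
  | nil => rfl
  | cons h l ih => simp [pend, ih]

theorem surv_congr {p q p' q' : ℕ → ℕ} {l : List ℕ} (b : ℕ)
    (h : ∀ k ∈ l, p' k = p k ∧ q' k = q k) : surv p' q' b l = surv p q b l := by
  induction l generalizing b with
  | nil => rfl
  | cons k l ih =>
    simp only [List.mem_cons, forall_eq_or_imp] at h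
    simp [surv, h.1.1, h.1.2, ih _ h.2]

theorem pend_congr {p q p' q' : ℕ → ℕ} {l : List ℕ} (b : ℕ)
    (h : ∀ k ∈ l, p' k = p k ∧ q' k = q k) : pend p' q' b l = pend p q b l := by
  induction l generalizing b with
  | nil => rfl
  | cons k l ih =>
    simp only [List.mem_cons, forall_eq_or_imp] at h
    simp [pend, h.1.1, h.1.2, ih _ h.2]

theorem redStep_false (s : List Entry) (r : Root) : redStep s (false, r) = s ++ [(false, r)] := by
  simp [redStep]

theorem foldl_redStep_replicate_false (s : List Entry) (r : Root) (m : ℕ) :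
    (List.replicate m ((false, r) : Entry)).foldl redStep s =
      s ++ List.replicate m (false, r) := by
  induction m generalizing s with
  | zero => simp
  | succ m ih => simp [List.replicate_succ, redStep_false, ih]

theorem redStep_true_of_pluses {P : List Entry} (hP : ∀ e ∈ P, e.1 = true) (r : Root) :
    redStep P (true, r) = P ++ [(true, r)] := by
  rcases List.eq_nil_or_concat P with rfl | ⟨P', e, rfl⟩
  · simp [redStep]
  · have := hP e (by simp)
    obtain ⟨e1, e2⟩ := e
    simp only at this
    subst this
    simp [redStep]

theorem redStep_true_concat (s : List Entry) (r r' : Root) :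
    redStep (s ++ [(false, r')]) (true, r) = s := by
  simp [redStep]

theorem foldl_redStep_replicate_true (r : Root) (m : ℕ) {P M : List Entry}
    (hP : ∀ e ∈ P, e.1 = true) (hM : ∀ e ∈ M, e.1 = false) :
    (List.replicate m ((true, r) : Entry)).foldl redStep (P ++ M) =
      (P ++ List.replicate (m - M.length) (true, r)) ++ M.take (M.length - m) := by
  induction m generalizing P M with
  | zero => simp
  | succ m ih =>
    rcases List.eq_nil_or_concat M with rfl | ⟨M', e, rfl⟩
    · have := ih (P := P ++ [(true, r)]) (M := []) (by
        intro e he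
        rcases List.mem_append.1 he with he | he
        · exact hP e he
        · simp_all) (by simp)
      simp only [List.append_nil] at this ⊢
      rw [List.replicate_succ, List.foldl_cons, redStep_true_of_pluses hP, this]
      simp [List.replicate_succ]
    · have he := hM e (by simp)
      obtain ⟨e1, e2⟩ := e
      simp only at he
      subst he
      rw [List.replicate_succ, List.foldl_cons, List.concat_eq_append, ← List.append_assoc,
        redStep_true_concat, ih hP fun e he => hM e (by simp [he])]
      simp [List.take_append]

theorem foldl_redStep_blockWord (p q : ℕ → ℕ) (r r' : ℕ → Root) (l : List ℕ) {P M : List Entry}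
    (hP : ∀ e ∈ P, e.1 = true) (hM : ∀ e ∈ M, e.1 = false) :
    ∃ M' : List Entry, (∀ e ∈ M', e.1 = false) ∧ M'.length = pend p q M.length l ∧
      (blockWord p q r r' l).foldl redStep (P ++ M) =
        (P ++ survList p q r M.length l) ++ M' := by
  induction l generalizing P M with
  | nil => exact ⟨M, hM, rfl, by simp [blockWord, survList]⟩
  | cons h l ih =>
    have hP' : ∀ e ∈ P ++ List.replicate (p h - M.length) ((true, r h) : Entry), e.1 = true := by
      intro e he
      rcases List.mem_append.1 he with he | he
      · exact hP e he
      · rw [(List.mem_replicate.1 he).2]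
    have hM' : ∀ e ∈ M.take (M.length - p h) ++ List.replicate (q h) ((false, r' h) : Entry),
        e.1 = false := by
      intro e he
      rcases List.mem_append.1 he with he | he
      · exact hM e (List.mem_of_mem_take he)
      · rw [(List.mem_replicate.1 he).2]
    obtain ⟨M', h1, h2, h3⟩ := ih hP' hM'
    have hlen : (M.take (M.length - p h) ++
        List.replicate (q h) ((false, r' h) : Entry)).length = (M.length - p h) + q h := by
      simp
    rw [hlen] at h2 h3
    refine ⟨M', h1, h2, ?_⟩
    have hb : blockWord p q r r' (h :: l) = (List.replicate (p h) ((true, r h) : Entry) ++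
        List.replicate (q h) ((false, r' h) : Entry)) ++ blockWord p q r r' l := by
      simp [blockWord]
    rw [hb, List.foldl_append, List.foldl_append, foldl_redStep_replicate_true _ _ hP hM,
      foldl_redStep_replicate_false, List.append_assoc _ (List.take _ _), h3]
    simp [survList]

theorem reduceW_blockWord (p q : ℕ → ℕ) (r r' : ℕ → Root) (l : List ℕ) :
    ∃ M : List Entry, (∀ e ∈ M, e.1 = false) ∧ M.length = pend p q 0 l ∧
      reduceW (blockWord p q r r' l) = survList p q r 0 l ++ M := by
  simpa [reduceW] using
    foldl_redStep_blockWord p q r r' l (P := []) (M := []) (by simp) (by simp)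

theorem filter_plus_reduceW_blockWord (p q : ℕ → ℕ) (r r' : ℕ → Root) (l : List ℕ) :
    (reduceW (blockWord p q r r' l)).filter (fun e => e.1) = survList p q r 0 l := by
  obtain ⟨M, hM, -, h⟩ := reduceW_blockWord p q r r' l
  rw [h, List.filter_append, List.filter_eq_self.2 (survList_fst p q r 0 l),
    List.filter_eq_nil_iff.2 fun e he => by simp [hM e he], List.append_nil]

theorem plusCt_reduceW_blockWord (p q : ℕ → ℕ) (r r' : ℕ → Root) (l : List ℕ) :
    plusCt (reduceW (blockWord p q r r' l)) = surv p q 0 l := by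
  rw [plusCt, filter_plus_reduceW_blockWord, length_survList]

theorem minusCt_reduceW_blockWord (p q : ℕ → ℕ) (r r' : ℕ → Root) (l : List ℕ) :
    minusCt (reduceW (blockWord p q r r' l)) = pend p q 0 l := by
  obtain ⟨M, hM, hl, h⟩ := reduceW_blockWord p q r r' l
  rw [minusCt, h, List.filter_append,
    List.filter_eq_nil_iff.2 fun e he => by simp [survList_fst p q r 0 l e he],
    List.filter_eq_self.2 fun e he => by simp [hM e he], List.nil_append, hl]

/-- `h` is the block of the rightmost surviving plus, for the reading order `l`. -/
def IsLastPlus (p q : ℕ → ℕ) (l : List ℕ) (b h : ℕ) : Prop :=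
  ∃ l₁ l₂, l = l₁ ++ h :: l₂ ∧ pend p q b l₁ < p h ∧ surv p q (pend p q b (l₁ ++ [h])) l₂ = 0

theorem exists_of_getLast?_survList (p q : ℕ → ℕ) (r : ℕ → Root) (b : ℕ) (l : List ℕ)
    {e : Entry} (he : (survList p q r b l).getLast? = some e) :
    ∃ h, e = (true, r h) ∧ IsLastPlus p q l b h := by
  induction l generalizing b with
  | nil => simp [survList] at he
  | cons k l ih =>
    rw [survList, List.getLast?_append] at he
    rcases hs : (survList p q r ((b - p k) + q k) l).getLast? with _ | e'
    · rw [hs, Option.none_or, List.getLast?_replicate] at he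
      have hnil := List.getLast?_eq_none_iff.1 hs
      split_ifs at he with h0
      refine ⟨k, (Option.some.inj he).symm, [], l, rfl, ?_, ?_⟩
      · simp only [pend]; omega
      · simpa [pend, hnil] using (length_survList p q r ((b - p k) + q k) l).symm
    · rw [hs, Option.some_or] at he
      obtain ⟨h, h1, l₁, l₂, h2, h3, h4⟩ := ih _ (he ▸ hs)
      exact ⟨h, h1, k :: l₁, l₂, by simp [h2], h3, h4⟩

theorem lastPlus_blockWord {p q : ℕ → ℕ} (r r' : ℕ → Root) {l : List ℕ}
    (hpos : 0 < surv p q 0 l) :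
    ∃ h, lastPlus (blockWord p q r r' l) = some (r h) ∧ IsLastPlus p q l 0 h := by
  rw [lastPlus, filter_plus_reduceW_blockWord]
  rcases hs : (survList p q r 0 l).getLast? with _ | e
  · rw [← length_survList p q r, List.getLast?_eq_none_iff.1 hs] at hpos
    simp at hpos
  · obtain ⟨h, rfl, hh⟩ := exists_of_getLast?_survList p q r 0 l hs
    exact ⟨h, rfl, hh⟩

theorem surv_pend_succ (p q : ℕ → ℕ) (b : ℕ) (l : List ℕ) :
    (surv p q b l = surv p q (b + 1) l + 1 ∧ pend p q (b + 1) l = pend p q b l) ∨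
      (surv p q b l = surv p q (b + 1) l ∧ pend p q (b + 1) l = pend p q b l + 1) := by
  induction l generalizing b with
  | nil => simp [surv, pend]
  | cons h l ih =>
    simp only [surv, pend]
    rcases Nat.lt_or_ge b (p h) with hb | hb
    · left
      have : b + 1 - p h = b - p h := by omega
      rw [this]
      exact ⟨by omega, rfl⟩
    · have : b + 1 - p h + q h = (b - p h + q h) + 1 := by omega
      rw [this]
      rcases ih (b - p h + q h) with h | h
      · left; omega
      · right; omega

/-- Turning the rightmost surviving plus into a minus. -/
theorem IsLastPlus.surv_pend_move {p q p' q' : ℕ → ℕ} {l : List ℕ} {h : ℕ} (hl : l.Nodup)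
    (hh : IsLastPlus p q l 0 h) (hne : ∀ k, k ≠ h → p' k = p k ∧ q' k = q k)
    (hp : p' h + 1 = p h) (hq : q' h = q h + 1) :
    surv p' q' 0 l + 1 = surv p q 0 l ∧ pend p' q' 0 l = pend p q 0 l + 1 := by
  obtain ⟨l₁, l₂, rfl, h1, h2⟩ := hh
  have hn : h ∉ l₁ ∧ h ∉ l₂ := by
    rw [List.nodup_middle, List.nodup_cons, List.mem_append] at hl
    tauto
  have e₁ : ∀ k ∈ l₁, p' k = p k ∧ q' k = q k := fun k hk => hne k (by rintro rfl; exact hn.1 hk)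
  have e₂ : ∀ k ∈ l₂, p' k = p k ∧ q' k = q k := fun k hk => hne k (by rintro rfl; exact hn.2 hk)
  simp only [surv_append, pend_append, surv, pend, surv_congr _ e₁, pend_congr _ e₁,
    surv_congr _ e₂, pend_congr _ e₂] at h2 ⊢
  generalize pend p q 0 l₁ = b at *
  have hb : b - p' h + q' h = (b - p h + q h) + 1 := by omega
  rw [hb]
  have := surv_pend_succ p q (b - p h + q h) l₂
  omega

/-- The effect on the surviving counts of inserting a plus or of deleting a minus. -/
def Raises (a b a' b' : ℕ) : Prop :=
  (a' = a ∧ b' = b) ∨ (a' = a + 1 ∧ b' = b) ∨ (a' = a ∧ b' + 1 = b)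

theorem raises_of_update {p q p' q' : ℕ → ℕ} {l : List ℕ} (h b : ℕ) (hl : l.Nodup)
    (hne : ∀ k, k ≠ h → p' k = p k ∧ q' k = q k)
    (hh : (p' h = p h + 1 ∧ q' h = q h) ∨ (p' h = p h ∧ q' h + 1 = q h)) :
    Raises (surv p q b l) (pend p q b l) (surv p' q' b l) (pend p' q' b l) := by
  induction l generalizing b with
  | nil => exact Or.inl ⟨rfl, rfl⟩
  | cons k l ih =>
    rw [List.nodup_cons] at hl
    simp only [surv, pend]
    by_cases hk : k = h
    · subst hk
      have e : ∀ m ∈ l, p' m = p m ∧ q' m = q m :=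
        fun m hm => hne m (by rintro rfl; exact hl.1 hm)
      simp only [surv_congr _ e, pend_congr _ e]
      have key : (p' k - b = p k - b + 1 ∧ b - p' k + q' k = b - p k + q k) ∨
          (p' k - b = p k - b ∧ b - p k + q k = (b - p' k + q' k) + 1) := by omega
      rcases key with ⟨h1, h2⟩ | ⟨h1, h2⟩
      · rw [h1, h2]
        exact Or.inr (Or.inl ⟨by omega, rfl⟩)
      · rw [h1, h2]
        have := surv_pend_succ p q (b - p' k + q' k) l
        unfold Raises
        omega
    · rw [(hne k hk).1, (hne k hk).2]
      have := ih (b - p k + q k) hl.2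
      unfold Raises at this ⊢
      omega

/-- A minus may be moved from a block `c` to the next block `d` without changing the reduced word
if block `c` has more minuses than block `d` has pluses. -/
theorem surv_pend_shift {p q p' q' : ℕ → ℕ} {l₁ l₂ : List ℕ} {c d : ℕ} (hcd : c ≠ d)
    (hl : (l₁ ++ c :: d :: l₂).Nodup) (hp : ∀ k, p' k = p k)
    (hne : ∀ k, k ≠ c → k ≠ d → q' k = q k) (hc : q' c + 1 = q c) (hd : q' d = q d + 1)
    (hlt : p d < q c) :
    surv p' q' 0 (l₁ ++ c :: d :: l₂) = surv p q 0 (l₁ ++ c :: d :: l₂) ∧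
      pend p' q' 0 (l₁ ++ c :: d :: l₂) = pend p q 0 (l₁ ++ c :: d :: l₂) := by
  rw [List.nodup_append] at hl
  have e₁ : ∀ k ∈ l₁, p' k = p k ∧ q' k = q k := fun k hk =>
    ⟨hp k, hne k (hl.2.2 k hk c (by simp)) (hl.2.2 k hk d (by simp))⟩
  have e₂ : ∀ k ∈ l₂, p' k = p k ∧ q' k = q k := fun k hk =>
    ⟨hp k, hne k (by rintro rfl; simp [hk] at hl) (by rintro rfl; simp [hk] at hl)⟩
  simp only [surv_append, pend_append, surv, pend, surv_congr _ e₁, pend_congr _ e₁,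
    surv_congr _ e₂, pend_congr _ e₂, hp]
  generalize pend p q 0 l₁ = b
  have h1 : b - p c + q' c - p d + q' d = b - p c + q c - p d + q d := by omega
  rw [h1]
  exact ⟨by omega, rfl⟩

theorem IsLastPlus.lt_of_eq {p q : ℕ → ℕ} {l₁ l₂ : List ℕ} {c d : ℕ}
    (hl : (l₁ ++ c :: d :: l₂).Nodup) (hh : IsLastPlus p q (l₁ ++ c :: d :: l₂) 0 d) :
    q c < p d := by
  obtain ⟨m₁, m₂, h1, h2, -⟩ := hh
  have hd : d ∉ l₁ ++ [c] ∧ d ∉ l₂ := by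
    have : l₁ ++ c :: d :: l₂ = (l₁ ++ [c]) ++ d :: l₂ := by simp
    rw [this, List.nodup_middle, List.nodup_cons, List.mem_append] at hl
    tauto
  have hm : m₁ = l₁ ++ [c] := by
    have h3 : (l₁ ++ [c]) ++ d :: l₂ = m₁ ++ d :: m₂ := by simpa using h1
    exact ((List.append_cons_inj_of_notMem hd.1 hd.2).1 h3).1.symm
  subst hm
  simp only [pend_append, pend] at h2
  omega

theorem range_split {m a : ℕ} (h : a + 1 < m) :
    ∃ l₁ l₂, List.range m = l₁ ++ a :: (a + 1) :: l₂ := by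
  refine ⟨List.range a, List.range' (a + 2) (m - a - 2), ?_⟩
  obtain ⟨c, rfl⟩ : ∃ c, m = a + (c + 2) := ⟨m - a - 2, by omega⟩
  have : a + (c + 2) - a - 2 = c := by omega
  rw [this, List.range_eq_range', List.range_eq_range', ← List.range'_append_1 (s := 0) (m := a)]
  simp [List.range'_succ]

theorem range_reverse_split {m a : ℕ} (h : a + 1 < m) :
    ∃ l₁ l₂, (List.range m).reverse = l₁ ++ (a + 1) :: a :: l₂ := by
  obtain ⟨l₁, l₂, h⟩ := range_split h
  exact ⟨l₂.reverse, l₁.reverse, by simp [h]⟩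

theorem nodup_range_reverse (m : ℕ) : (List.range m).reverse.Nodup :=
  List.nodup_reverse.2 List.nodup_range

theorem aSt_eq (n i : ℕ) (x : KPf) :
    aSt n i x = surv (fun h => x (h, i)) (fun h => x (h, i + 1)) 0 (List.range (n + 1)).reverse :=
  plusCt_reduceW_blockWord _ _ (fun h => (h, i)) (fun h => (h, i + 1)) _

theorem aStar_eq (n i : ℕ) (x : KPf) :
    aStar n i x = surv (fun k => x (i + 1, k)) (fun k => x (i, k)) 0 (List.range (n + 1)) :=
  plusCt_reduceW_blockWord _ _ (fun k => (i + 1, k)) (fun k => (i, k)) _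

theorem bSt_eq (n i : ℕ) (x : KPf) :
    bSt n i x = pend (fun h => x (h, i)) (fun h => x (h, i + 1)) 0 (List.range (n + 1)).reverse :=
  minusCt_reduceW_blockWord _ _ (fun h => (h, i)) (fun h => (h, i + 1)) _

theorem bStar_eq (n i : ℕ) (x : KPf) :
    bStar n i x = pend (fun k => x (i + 1, k)) (fun k => x (i, k)) 0 (List.range (n + 1)) :=
  minusCt_reduceW_blockWord _ _ (fun k => (i + 1, k)) (fun k => (i, k)) _

theorem KPmove_apply {x : KPf} {r r' : Root} (h : r ≠ r') (s : Root) :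
    KPmove x r r' s = if s = r' then x s + 1 else if s = r then x s - 1 else x s := by
  unfold KPmove KPadd KPsub
  split_ifs <;> simp_all

theorem IsKP.move {n : ℕ} {x : KPf} (hx : IsKP n x) {r r' : Root} (h : r ≠ r')
    (hr' : IsPos n r') : IsKP n (KPmove x r r') := by
  intro s hs
  rw [KPmove_apply h] at hs
  split_ifs at hs with h1 h2
  · exact h1 ▸ hr'
  · exact hx s (by omega)
  · exact hx s hs

/-- The two ways in which `f_i` can act. -/
theorem fop_cases {n i : ℕ} {x y : KPf} (hx : IsKP n x) (hf : fop n i x = some y) :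
    (bStar n i x < aSt n i x ∧ ∃ h, 1 ≤ h ∧ h < i ∧ 0 < x (h, i) ∧
      y = KPmove x (h, i) (h, i + 1) ∧
      IsLastPlus (fun h => x (h, i)) (fun h => x (h, i + 1)) (List.range (n + 1)).reverse 0 h) ∨
    (aSt n i x ≤ bStar n i x ∧ ∃ k, i + 1 < k ∧ k ≤ n ∧ 0 < x (i + 1, k) ∧
      y = KPmove x (i + 1, k) (i, k) ∧
      IsLastPlus (fun k => x (i + 1, k)) (fun k => x (i, k)) (List.range (n + 1)) 0 k) := by
  unfold fop at hf
  split_ifs at hf with h1 h2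
  · left
    refine ⟨h1, ?_⟩
    have hpos : 0 < aSt n i x := by omega
    rw [aSt_eq] at hpos
    obtain ⟨h, hl, hh⟩ := lastPlus_blockWord (fun h => (h, i)) (fun h => (h, i + 1)) hpos
    have hl' : lastPlus (Wword n i x) = some (h, i) := hl
    rw [ftilde, hl'] at hf
    have h0 : 0 < x (h, i) := by
      obtain ⟨_, _, _, h3, _⟩ := hh
      exact Nat.zero_lt_of_lt h3
    have := hx (h, i) h0.ne'
    exact ⟨h, this.1, this.2.1, h0, (Option.some.inj hf).symm, hh⟩
  · right
    refine ⟨by omega, ?_⟩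
    rw [aStar_eq] at h2
    obtain ⟨k, hl, hh⟩ := lastPlus_blockWord (fun k => (i + 1, k)) (fun k => (i, k)) h2
    have hl' : lastPlus (Wstar n i x) = some (i + 1, k) := hl
    rw [ftildeS, hl'] at hf
    have h0 : 0 < x (i + 1, k) := by
      obtain ⟨_, _, _, h3, _⟩ := hh
      exact Nat.zero_lt_of_lt h3
    have := hx (i + 1, k) h0.ne'
    exact ⟨k, this.2.1, this.2.2, h0, (Option.some.inj hf).symm, hh⟩

/-- The value of `φ_i`, see `phiS_eq`. -/
def phiVal (n i : ℕ) (x : KPf) : ℕ := aStar n i x + (aSt n i x - bStar n i x)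

theorem fop_spec {n i : ℕ} (hi1 : 1 ≤ i) (hi2 : i ≤ n - 1) {x y : KPf} (hx : IsKP n x)
    (hf : fop n i x = some y) : IsKP n y ∧ phiVal n i y + 1 = phiVal n i x := by
  rcases fop_cases hx hf with ⟨hlt, h, hh1, hhi, h0, rfl, hh⟩ | ⟨hle, k, hik, hkn, h0, rfl, hh⟩
  · have hne : ((h, i) : Root) ≠ (h, i + 1) := by simp
    refine ⟨hx.move hne ⟨hh1, by simp; omega, by simp; omega⟩, ?_⟩
    have e : ∀ s t, KPmove x (h, i) (h, i + 1) (s, t) = _ := fun s t => KPmove_apply hne (s, t)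
    have hW := hh.surv_pend_move (nodup_range_reverse _)
      (p' := fun s => KPmove x (h, i) (h, i + 1) (s, i))
      (q' := fun s => KPmove x (h, i) (h, i + 1) (s, i + 1))
      (by intro s hs; simp [e, hs]) (by simp [e]; omega) (by simp [e])
    have hS : ∀ s ∈ List.range (n + 1),
        (fun s => KPmove x (h, i) (h, i + 1) (i + 1, s)) s = (fun s => x (i + 1, s)) s ∧
        (fun s => KPmove x (h, i) (h, i + 1) (i, s)) s = (fun s => x (i, s)) s := by
      intro s _
      have h1 : i ≠ h := by omega
      have h2 : i + 1 ≠ h := by omega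
      simp [e, h1, h2]
    have hS1 := surv_congr 0 hS
    have hS2 := pend_congr 0 hS
    rw [← aSt_eq, ← aSt_eq, ← bSt_eq, ← bSt_eq] at hW
    rw [← aStar_eq, ← aStar_eq] at hS1
    rw [← bStar_eq, ← bStar_eq] at hS2
    unfold phiVal
    omega
  · have hne : ((i + 1, k) : Root) ≠ (i, k) := by simp
    refine ⟨hx.move hne ⟨hi1, by simp; omega, hkn⟩, ?_⟩
    have e : ∀ s t, KPmove x (i + 1, k) (i, k) (s, t) = _ := fun s t => KPmove_apply hne (s, t)
    have hS := hh.surv_pend_move List.nodup_range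
      (p' := fun s => KPmove x (i + 1, k) (i, k) (i + 1, s))
      (q' := fun s => KPmove x (i + 1, k) (i, k) (i, s))
      (by intro s hs; simp [e, hs]) (by simp [e]; omega) (by simp [e])
    have hW : ∀ s ∈ (List.range (n + 1)).reverse,
        (fun s => KPmove x (i + 1, k) (i, k) (s, i)) s = (fun s => x (s, i)) s ∧
        (fun s => KPmove x (i + 1, k) (i, k) (s, i + 1)) s = (fun s => x (s, i + 1)) s := by
      intro s _
      have h1 : i ≠ k := by omega
      have h2 : i + 1 ≠ k := by omega
      simp [e, h1, h2]
    have hW1 := surv_congr 0 hW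
    rw [← aStar_eq, ← aStar_eq, ← bStar_eq, ← bStar_eq] at hS
    rw [← aSt_eq, ← aSt_eq] at hW1
    unfold phiVal
    omega

theorem fop_eq_none_iff (n i : ℕ) (x : KPf) : fop n i x = none ↔ phiVal n i x = 0 := by
  have h1 : ftilde n i x ≠ none := by unfold ftilde; split <;> simp
  have h2 : ftildeS n i x ≠ none := by unfold ftildeS; split <;> simp
  unfold fop phiVal
  split_ifs
  · simp only [h1, false_iff]; omega
  · simp only [h2, false_iff]; omega
  · simp only [true_iff]; omega

theorem iterO_fop_ne_none_iff {n i : ℕ} (hi1 : 1 ≤ i) (hi2 : i ≤ n - 1) (k : ℕ) {x : KPf}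
    (hx : IsKP n x) : iterO (fop n i) k x ≠ none ↔ k ≤ phiVal n i x := by
  induction k generalizing x with
  | zero => simp [iterO]
  | succ k ih =>
    rw [iterO]
    rcases hf : fop n i x with _ | y
    · simp [(fop_eq_none_iff n i x).1 hf]
    · obtain ⟨hy, h⟩ := fop_spec hi1 hi2 hx hf
      rw [Option.bind_some, ih hy]
      omega

theorem phiS_eq {n i : ℕ} (hi1 : 1 ≤ i) (hi2 : i ≤ n - 1) {x : KPf} (hx : IsKP n x) :
    phiS n i x = phiVal n i x := by
  have : {k | iterO (fop n i) k x ≠ none} = Set.Iic (phiVal n i x) :=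
    Set.ext fun k => iterO_fop_ne_none_iff hi1 hi2 k hx
  rw [phiS, this, csSup_Iic]

theorem phiVal_of_raises {n j : ℕ} {x y : KPf}
    (h : (aSt n j y = aSt n j x ∧
        Raises (aStar n j x) (bStar n j x) (aStar n j y) (bStar n j y)) ∨
      (aStar n j y = aStar n j x ∧ bStar n j y = bStar n j x ∧
        Raises (aSt n j x) (bSt n j x) (aSt n j y) (bSt n j y))) :
    phiVal n j y = phiVal n j x ∨ phiVal n j y = phiVal n j x + 1 := by
  unfold Raises at h
  unfold phiVal
  omega

theorem phiVal_fop_succ {n i : ℕ} {x y : KPf} (hx : IsKP n x)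
    (hf : fop n i x = some y) :
    phiVal n (i + 1) y = phiVal n (i + 1) x ∨ phiVal n (i + 1) y = phiVal n (i + 1) x + 1 := by
  apply phiVal_of_raises
  simp only [aSt_eq, bSt_eq, aStar_eq, bStar_eq]
  rcases fop_cases hx hf with ⟨-, h, -, hhi, h0, rfl, hh⟩ | ⟨-, k, hik, hkn, h0, rfl, hh⟩
  · right
    have hne : ((h, i) : Root) ≠ (h, i + 1) := by simp
    have e : ∀ s t, KPmove x (h, i) (h, i + 1) (s, t) = _ := fun s t => KPmove_apply hne (s, t)
    have h1 : i + 1 ≠ h := by omega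
    have h2 : i + 1 + 1 ≠ h := by omega
    refine ⟨surv_congr 0 ?_, pend_congr 0 ?_,
      raises_of_update h 0 (nodup_range_reverse _) ?_ (Or.inl ?_)⟩
    · intro s _; simp [e, h1, h2]
    · intro s _; simp [e, h1, h2]
    · intro s hs; simp [e, hs]
    · have h3 : i + 1 + 1 ≠ i := by omega
      simp [e, h3]
  · left
    have hne : ((i + 1, k) : Root) ≠ (i, k) := by simp
    have e : ∀ s t, KPmove x (i + 1, k) (i, k) (s, t) = _ := fun s t => KPmove_apply hne (s, t)
    refine ⟨?_, raises_of_update k 0 List.nodup_range ?_ (Or.inr ?_)⟩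
    · by_cases hk : k = i + 1 + 1
      · subst hk
        obtain ⟨l₁, l₂, hl⟩ := range_split (m := n + 1) (a := i + 1) (by omega)
        have hlt : x (i, i + 1) < x (i + 1, i + 1 + 1) :=
          (hl ▸ hh).lt_of_eq (hl ▸ List.nodup_range)
        obtain ⟨m₁, m₂, hm⟩ := range_reverse_split (m := n + 1) (a := i) (by omega)
        rw [hm]
        refine (surv_pend_shift (by omega) (hm ▸ nodup_range_reverse _) ?_ ?_ ?_ ?_ hlt).1
        · intro s; simp [e]
        · intro s hs1 hs2; simp [e, hs1, hs2]
        · simp [e]; omega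
        · simp [e]
      · refine surv_congr 0 ?_
        intro s _
        have h1 : i + 1 ≠ k := by omega
        have h2 : i + 1 + 1 ≠ k := by omega
        simp [e, h1, h2]
    · intro s hs; simp [e, hs]
    · simp [e]; omega

theorem phiVal_fop_pred {n j : ℕ} (hj : j + 1 ≤ n - 1) {x y : KPf} (hx : IsKP n x)
    (hf : fop n (j + 1) x = some y) :
    phiVal n j y = phiVal n j x ∨ phiVal n j y = phiVal n j x + 1 := by
  apply phiVal_of_raises
  simp only [aSt_eq, bSt_eq, aStar_eq, bStar_eq]
  rcases fop_cases hx hf with ⟨-, h, -, hhi, h0, rfl, hh⟩ | ⟨-, k, hik, hkn, h0, rfl, hh⟩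
  · right
    have hne : ((h, j + 1) : Root) ≠ (h, j + 1 + 1) := by simp
    have e : ∀ s t, KPmove x (h, j + 1) (h, j + 1 + 1) (s, t) = _ :=
      fun s t => KPmove_apply hne (s, t)
    have h1 : j + 1 ≠ h := by omega
    rw [← and_assoc]
    refine ⟨?_, raises_of_update h 0 (nodup_range_reverse _) ?_ (Or.inr ?_)⟩
    · by_cases hj' : h = j
      · subst hj'
        obtain ⟨m₁, m₂, hm⟩ := range_reverse_split (m := n + 1) (a := h) (by omega)
        have hlt : x (h + 1, h + 1 + 1) < x (h, h + 1) :=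
          (hm ▸ hh).lt_of_eq (hm ▸ nodup_range_reverse _)
        obtain ⟨l₁, l₂, hl⟩ := range_split (m := n + 1) (a := h + 1) (by omega)
        rw [hl]
        refine surv_pend_shift (by omega) (hl ▸ List.nodup_range) ?_ ?_ ?_ ?_ hlt
        · intro s; simp [e]
        · intro s hs1 hs2; simp [e, hs1, hs2]
        · simp [e]; omega
        · simp [e]
      · have h2 : j ≠ h := Ne.symm hj'
        exact ⟨surv_congr 0 fun s _ => by simp [e, h1, h2],
          pend_congr 0 fun s _ => by simp [e, h1, h2]⟩
    · intro s hs; simp [e, hs]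
    · simp [e]; omega
  · left
    have hne : ((j + 1 + 1, k) : Root) ≠ (j + 1, k) := by simp
    have e : ∀ s t, KPmove x (j + 1 + 1, k) (j + 1, k) (s, t) = _ :=
      fun s t => KPmove_apply hne (s, t)
    have h1 : j ≠ k := by omega
    have h2 : j + 1 ≠ k := by omega
    have h3 : j ≠ j + 1 + 1 := by omega
    refine ⟨surv_congr 0 fun s _ => by simp [e, h1, h2],
      raises_of_update k 0 List.nodup_range ?_ (Or.inl ?_)⟩
    · intro s hs; simp [e, hs]
    · simp [e, h3]

end KFC

open KFC in
/-- Stembridge axiom S1' (adjacent case) for the modified operators: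
if `|i−j| = 1` and `f_i(x) ≠ 0`, then `φ_j(f_i(x))` equals `φ_j(x)` or
`φ_j(x) + 1`. -/
theorem stmt14 (n : ℕ) (hn : 2 ≤ n) (i j : ℕ)
    (hi1 : 1 ≤ i) (hi2 : i ≤ n - 1) (hj1 : 1 ≤ j) (hj2 : j ≤ n - 1) (hij : j = i + 1 ∨ i = j + 1)
    (x : KPf) (hx : IsKP n x) (hf : fop n i x ≠ none) :
    phiO n j (fop n i x) = phiS n j x ∨ phiO n j (fop n i x) = phiS n j x + 1 := by
  obtain ⟨y, hy⟩ := Option.ne_none_iff_exists'.1 hf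
  rw [hy, phiS_eq hj1 hj2 hx]
  change phiS n j y = _ ∨ phiS n j y = _
  rw [phiS_eq hj1 hj2 (fop_spec hi1 hi2 hx hy).1]
  rcases hij with rfl | rfl
  · exact phiVal_fop_succ hx hy
  · exact phiVal_fop_pred hi2 hx hy
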